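/- Let n ≥ 4, let m be a positive integer, and let B_1, ..., B_m be real skew-symmetric n×n matrices. Then Σ_{r,s=1}^m ‖[B_r,B_s]‖² ≤ (2/3)·(Σ_{r=1}^m ‖B_r‖²)². -/

import Mathlib

open Matrix BigOperators

/-- Squared Frobenius norm of a real square matrix. -/
def frobSq {n : ℕ} (A : Matrix (Fin n) (Fin n) ℝ) : ℝ := ∑ i, ∑ j, (A i j) ^ 2

/-- Commutator of two square matrices. -/
def matComm {n : ℕ} (A B : Matrix (Fin n) (Fin n) ℝ) : Matrix (Fin n) (Fin n) ℝ :=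
  A * B - B * A

lemma sum_star_excess_le {ι : Type*} (J : Finset ι) (x : ι → ℝ) (a : ℝ)
    (h : a ^ 2 + ∑ q ∈ J, x q ^ 2 ≤ 1 / 2) :
    ∑ q ∈ J, ((a + x q) ^ 2 - 2 / 3) ≤ 1 / 3 := by
  have e : ∑ q ∈ J, ((a + x q) ^ 2 - 2 / 3)
      = J.card * a ^ 2 + 2 * a * ∑ q ∈ J, x q + ∑ q ∈ J, x q ^ 2 - J.card * (2 / 3) := by
    simp only [Finset.mul_sum, add_sq, Finset.sum_add_distrib, Finset.sum_sub_distrib,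
      Finset.sum_const, nsmul_eq_mul]
  rcases J.eq_empty_or_nonempty with rfl | hJ
  · simp
  have hk : (1 : ℝ) ≤ J.card := by exact_mod_cast hJ.card_pos
  have hcs : (∑ q ∈ J, x q) ^ 2 ≤ J.card * ∑ q ∈ J, x q ^ 2 := sq_sum_le_card_mul_sum_sq
  rw [e]
  nlinarith [sq_nonneg (a - ∑ q ∈ J, x q)]

/-- For weights bounded by `1 / 2` and nonnegative numbers with square sum at most `1 / 2`, only the
pairs containing the largest number contribute positively. -/
lemma sum_pair_excess_le {ι : Type*} [DecidableEq ι] (P : Finset ι) (x : ι → ℝ) (w : ι → ι → ℝ)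
    (hx : ∀ p ∈ P, 0 ≤ x p) (hsum : ∑ p ∈ P, x p ^ 2 ≤ 1 / 2)
    (hw0 : ∀ p q, 0 ≤ w p q) (hw1 : ∀ p q, w p q ≤ 1 / 2)
    (hws : ∀ p q, w p q = w q p) (hwd : ∀ p, w p p = 0) :
    ∑ p ∈ P, ∑ q ∈ P, w p q * ((x p + x q) ^ 2 - 2 / 3) ≤ 1 / 3 := by
  rcases P.eq_empty_or_nonempty with rfl | hP
  · simp
  obtain ⟨p₀, hp₀, hmax⟩ := P.exists_max_image x hP
  have hdisj : ∀ q ∈ P.erase p₀, ∀ r ∈ P.erase p₀,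
      w q r * ((x q + x r) ^ 2 - 2 / 3) ≤ 0 := by
    intro q hq r hr
    rcases eq_or_ne q r with rfl | hqr
    · simp [hwd]
    rw [Finset.mem_erase] at hq hr
    refine mul_nonpos_of_nonneg_of_nonpos (hw0 _ _) ?_
    have h3 : x p₀ ^ 2 + (x q ^ 2 + x r ^ 2) ≤ 1 / 2 := by
      refine le_trans ?_ hsum
      have : ∑ p ∈ ({p₀, q, r} : Finset ι), x p ^ 2 = x p₀ ^ 2 + (x q ^ 2 + x r ^ 2) := by
        rw [Finset.sum_insert (by simp [hq.1.symm, hr.1.symm]), Finset.sum_pair hqr]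
      rw [← this]
      refine Finset.sum_le_sum_of_subset_of_nonneg ?_ fun _ _ _ => sq_nonneg _
      intro y hy
      simp only [Finset.mem_insert, Finset.mem_singleton] at hy
      rcases hy with rfl | rfl | rfl
      exacts [hp₀, hq.2, hr.2]
    have hq' := hmax q hq.2
    have hr' := hmax r hr.2
    have := hx q hq.2
    have := hx r hr.2
    have h1 : (x q + x r) ^ 2 ≤ (x p₀ + x r) ^ 2 := by gcongr
    have h2 : (x q + x r) ^ 2 ≤ (x q + x p₀) ^ 2 := by gcongr
    nlinarith [sq_nonneg (x p₀ - x r), sq_nonneg (x q - x p₀), sq_nonneg (x q - x r)]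
  have hstar : ∑ q ∈ P.erase p₀, w p₀ q * ((x p₀ + x q) ^ 2 - 2 / 3) ≤ 1 / 6 := by
    set J := (P.erase p₀).filter fun q => 0 ≤ (x p₀ + x q) ^ 2 - 2 / 3 with hJ
    have h1 : ∑ q ∈ P.erase p₀, w p₀ q * ((x p₀ + x q) ^ 2 - 2 / 3)
        ≤ ∑ q ∈ J, 1 / 2 * ((x p₀ + x q) ^ 2 - 2 / 3) := by
      rw [hJ, Finset.sum_filter]
      refine Finset.sum_le_sum fun q _ => ?_
      split_ifs with h
      · exact mul_le_mul_of_nonneg_right (hw1 _ _) h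
      · exact mul_nonpos_of_nonneg_of_nonpos (hw0 _ _) (not_le.1 h).le
    have h2 : x p₀ ^ 2 + ∑ q ∈ J, x q ^ 2 ≤ 1 / 2 := by
      refine le_trans ?_ hsum
      rw [← Finset.add_sum_erase _ _ hp₀]
      gcongr
      exact Finset.filter_subset _ _
    have h3 := sum_star_excess_le J x (x p₀) h2
    rw [← Finset.mul_sum] at h1
    linarith
  have hrow : ∀ q ∈ P.erase p₀, ∑ r ∈ P, w q r * ((x q + x r) ^ 2 - 2 / 3)
      ≤ w p₀ q * ((x p₀ + x q) ^ 2 - 2 / 3) := by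
    intro q hq
    rw [← Finset.add_sum_erase _ _ hp₀, hws q p₀, add_comm (x q) (x p₀)]
    linarith [Finset.sum_nonpos (hdisj q hq)]
  rw [← Finset.add_sum_erase _ _ hp₀]
  have h4 := Finset.sum_le_sum hrow
  have h5 : ∑ q ∈ P, w p₀ q * ((x p₀ + x q) ^ 2 - 2 / 3)
      = ∑ q ∈ P.erase p₀, w p₀ q * ((x p₀ + x q) ^ 2 - 2 / 3) := by
    rw [← Finset.add_sum_erase _ _ hp₀, hwd]; simp
  linarith

lemma sum_weight_mul_add_sq_le {ι : Type*} [Fintype ι] [DecidableEq ι] (x : ι → ℝ)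
    (w : ι → ι → ℝ) (hpos : ∑ p with 0 < x p, x p ^ 2 ≤ 1 / 2)
    (hneg : ∑ p with ¬ 0 < x p, x p ^ 2 ≤ 1 / 2)
    (hw0 : ∀ p q, 0 ≤ w p q) (hw1 : ∀ p q, w p q ≤ 1 / 2)
    (hws : ∀ p q, w p q = w q p) (hwd : ∀ p, w p p = 0) :
    ∑ p, ∑ q, w p q * (x p + x q) ^ 2 ≤ 2 / 3 * (∑ p, ∑ q, w p q + 1) := by
  set P := Finset.univ.filter fun p => 0 < x p with hP
  set N := Finset.univ.filter fun p => ¬ 0 < x p with hN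
  have hsplit : ∀ f : ι → ℝ, ∑ p, f p = ∑ p ∈ P, f p + ∑ p ∈ N, f p := fun f =>
    (Finset.sum_filter_add_sum_filter_not _ _ _).symm
  have hPP := sum_pair_excess_le P x w (fun p hp => (Finset.mem_filter.1 hp).2.le) hpos
    hw0 hw1 hws hwd
  have hNN := sum_pair_excess_le N (fun p => -x p) w
    (fun p hp => neg_nonneg.2 (not_lt.1 (Finset.mem_filter.1 hp).2)) (by simpa using hneg)
    hw0 hw1 hws hwd
  have hmix : ∀ p ∈ P, ∀ q ∈ N, w p q * ((x p + x q) ^ 2 - 2 / 3) ≤ 0 := by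
    intro p hp q hq
    refine mul_nonpos_of_nonneg_of_nonpos (hw0 _ _) ?_
    have h1 : x p ^ 2 ≤ 1 / 2 :=
      (Finset.single_le_sum (f := fun p => x p ^ 2) (fun _ _ => sq_nonneg _) hp).trans hpos
    have h2 : x q ^ 2 ≤ 1 / 2 :=
      (Finset.single_le_sum (f := fun p => x p ^ 2) (fun _ _ => sq_nonneg _) hq).trans hneg
    have h3 : 0 < x p := (Finset.mem_filter.1 hp).2
    have h4 : x q ≤ 0 := not_lt.1 (Finset.mem_filter.1 hq).2
    rcases le_total 0 (x p + x q) with h | h <;> nlinarith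
  have hPN := Finset.sum_nonpos fun p hp => Finset.sum_nonpos (hmix p hp)
  have hNP : ∑ p ∈ N, ∑ q ∈ P, w p q * ((x p + x q) ^ 2 - 2 / 3) ≤ 0 :=
    Finset.sum_nonpos fun p hp => Finset.sum_nonpos fun q hq => by
      rw [hws, add_comm (x p)]; exact hmix q hq p hp
  have hNN' : ∑ p ∈ N, ∑ q ∈ N, w p q * ((x p + x q) ^ 2 - 2 / 3) ≤ 1 / 3 := by
    refine le_trans (le_of_eq ?_) hNN
    refine Finset.sum_congr rfl fun p _ => Finset.sum_congr rfl fun q _ => ?_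
    ring
  have htot : ∑ p, ∑ q, w p q * ((x p + x q) ^ 2 - 2 / 3) ≤ 2 / 3 := by
    simp only [hsplit, Finset.sum_add_distrib]
    linarith
  simp only [mul_sub, Finset.sum_sub_distrib, ← Finset.sum_mul] at htot
  linarith

/-- Layer-cake bound for a nonnegative quadratic form: a bound on the column sums of all principal
submatrices bounds the form. -/
lemma quadratic_le_of_column_sums {ι : Type*} [Fintype ι] [DecidableEq ι] (M : ι → ι → ℝ) (c : ℝ)
    (hsymm : ∀ r s, M r s = M s r)
    (hM : ∀ K : Finset ι, ∀ s ∈ K, ∑ r ∈ K, M r s ≤ c * K.card) (x : ι → ℝ) (hx : ∀ r, 0 ≤ x r) :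
    ∑ r, ∑ s, x r * x s * M r s ≤ c * (∑ r, x r) ^ 2 := by
  induction hk : (Finset.univ.filter fun r => x r ≠ 0).card using Nat.strong_induction_on
    generalizing x with
  | _ k ih =>
    set K := Finset.univ.filter fun r => x r ≠ 0 with hK
    rcases K.eq_empty_or_nonempty with hKe | hKne
    · have : ∀ r, x r = 0 := by
        intro r
        by_contra h
        have : r ∈ K := by simp [hK, h]
        simp [hKe] at this
      simp [this]
    obtain ⟨r₀, hr₀, hmin⟩ := K.exists_min_image x hKne
    set t := x r₀ with ht
    have ht0 : t ≠ 0 := (Finset.mem_filter.1 hr₀).2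
    set u : ι → ℝ := fun r => if r ∈ K then 1 else 0 with hu
    set y : ι → ℝ := fun r => x r - t * u r with hy
    have hxK : ∀ r, r ∉ K → x r = 0 := fun r hr => by simpa [hK] using hr
    have hyK : ∀ r, r ∉ K → y r = 0 := fun r hr => by simp [hy, hu, hr, hxK r hr]
    have hy0 : ∀ r, 0 ≤ y r := by
      intro r
      by_cases hr : r ∈ K
      · simpa [hy, hu, hr] using hmin r hr
      · exact (hyK r hr).ge
    have hylt : (Finset.univ.filter fun r => y r ≠ 0).card < k := by
      rw [← hk]
      refine Finset.card_lt_card (Finset.ssubset_iff_subset_ne.2 ⟨fun r hr => ?_, fun h => ?_⟩)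
      · by_contra hr'
        exact (Finset.mem_filter.1 hr).2 (hyK r hr')
      · rw [← h] at hr₀
        refine (Finset.mem_filter.1 hr₀).2 ?_
        have : r₀ ∈ K := by simpa [hK] using ht0
        simp [hy, hu, this, ht]
    have hyy := ih _ hylt y hy0 rfl
    have hcol : ∀ z : ι → ℝ, (∀ r, 0 ≤ z r) → (∀ r, r ∉ K → z r = 0) →
        ∑ r, ∑ s, u r * z s * M r s ≤ c * K.card * ∑ s, z s := by
      intro z hz0 hzK
      rw [Finset.sum_comm, Finset.mul_sum]
      refine Finset.sum_le_sum fun s _ => ?_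
      by_cases hs : s ∈ K
      · have : ∑ r, u r * z s * M r s = z s * ∑ r ∈ K, M r s := by
          simp only [hu, ite_mul, one_mul, zero_mul, Finset.sum_ite_mem, Finset.univ_inter,
            Finset.mul_sum]
        rw [this, mul_comm _ (z s)]
        exact mul_le_mul_of_nonneg_left (hM K s hs) (hz0 s)
      · simp [hzK s hs]
    have huu := hcol u (fun r => by simp only [hu]; split_ifs <;> norm_num)
      fun r hr => by simp [hu, hr]
    have huy := hcol y hy0 hyK
    have hyu : ∑ r, ∑ s, y r * u s * M r s = ∑ r, ∑ s, u r * y s * M r s := by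
      rw [Finset.sum_comm]
      refine Finset.sum_congr rfl fun r _ => Finset.sum_congr rfl fun s _ => ?_
      rw [hsymm s r]; ring
    have hsu : ∑ s, u s = K.card := by simp [hu]
    have hxs : ∑ s, x s = t * K.card + ∑ s, y s := by
      simp only [hy, Finset.sum_sub_distrib, ← Finset.mul_sum, hsu]; ring
    have hexp : ∑ r, ∑ s, x r * x s * M r s = t ^ 2 * ∑ r, ∑ s, u r * u s * M r s
        + t * ∑ r, ∑ s, u r * y s * M r s + t * ∑ r, ∑ s, y r * u s * M r s
        + ∑ r, ∑ s, y r * y s * M r s := by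
      simp only [Finset.mul_sum, ← Finset.sum_add_distrib]
      refine Finset.sum_congr rfl fun r _ => Finset.sum_congr rfl fun s _ => ?_
      simp only [hy]; ring
    have ht' : 0 ≤ t := hx r₀
    rw [hexp, hyu, hxs]
    rw [hsu] at huu
    nlinarith [mul_le_mul_of_nonneg_left huu (sq_nonneg t), mul_le_mul_of_nonneg_left huy ht']

lemma sum_sq_vecMul_of_orthogonal {ι : Type*} [Fintype ι] [DecidableEq ι] (U : Matrix ι ι ℝ)
    (hU : U * Uᵀ = 1) (v : ι → ℝ) : ∑ k, (∑ r, v r * U r k) ^ 2 = ∑ r, v r ^ 2 := by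
  have h : (v ᵥ* U) ⬝ᵥ (v ᵥ* U) = v ⬝ᵥ v := by
    rw [← dotProduct_mulVec, ← vecMul_transpose, vecMul_vecMul, hU, vecMul_one]
  simpa [dotProduct, vecMul, sq] using h

lemma sum_norm_sq_eq_trace {ι : Type*} [Fintype ι] (X : Matrix ι ι ℂ) :
    ((∑ i, ∑ j, ‖X i j‖ ^ 2 : ℝ) : ℂ) = trace (Xᴴ * X) := by
  simp only [trace, diag, mul_apply, conjTranspose_apply]
  rw [Finset.sum_comm]
  push_cast
  refine Finset.sum_congr rfl fun i _ => Finset.sum_congr rfl fun j _ => ?_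
  exact (Complex.conj_mul' _).symm

lemma sum_norm_sq_mul_mul_of_unitary {ι : Type*} [Fintype ι] [DecidableEq ι]
    (U V X : Matrix ι ι ℂ) (hU : Uᴴ * U = 1) (hV : V * Vᴴ = 1) :
    ∑ i, ∑ j, ‖(U * X * V) i j‖ ^ 2 = ∑ i, ∑ j, ‖X i j‖ ^ 2 := by
  have : trace ((U * X * V)ᴴ * (U * X * V)) = trace (Xᴴ * X) := by
    calc trace ((U * X * V)ᴴ * (U * X * V))
        = trace (Vᴴ * (Xᴴ * (Uᴴ * U) * X * V)) := by
          simp only [conjTranspose_mul, Matrix.mul_assoc]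
      _ = trace (Xᴴ * X) := by
          rw [hU, trace_mul_comm, Matrix.mul_assoc, hV]; simp
  rw [← sum_norm_sq_eq_trace, ← sum_norm_sq_eq_trace] at this
  exact_mod_cast this

/-- The spectrum of a Hermitian matrix with `Hᵀ = -H` is symmetric about `0`. -/
lemma sum_eigenvalues_neg {ι : Type*} [Fintype ι] [DecidableEq ι] {H : Matrix ι ι ℂ}
    (hH : H.IsHermitian) (hT : Hᵀ = -H) (f : ℝ → ℝ) :
    ∑ i, f (hH.eigenvalues i) = ∑ i, f (-hH.eigenvalues i) := by
  have hroots := hH.roots_charpoly_eq_eigenvalues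
  have hneg : H.charpoly = ∏ i, (Polynomial.X - Polynomial.C (-(hH.eigenvalues i : ℂ))) := by
    have h1 : H.charpoly = (-H).charpoly := by rw [← hT, charpoly_transpose]
    have h2 : (-H).charpoly = (diagonal fun i => -(hH.eigenvalues i : ℂ)).charpoly := by
      have h3 : -H = (hH.eigenvectorUnitary : Matrix ι ι ℂ) *
          (diagonal fun i => -(hH.eigenvalues i : ℂ)) *
          star (hH.eigenvectorUnitary : Matrix ι ι ℂ) := by
        conv_lhs => rw [hH.spectral_theorem, Unitary.conjStarAlgAut_apply]
        rw [← Matrix.diagonal_neg (fun i => (hH.eigenvalues i : ℂ))]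
        simp only [Function.comp_def, Matrix.mul_neg, Matrix.neg_mul]
        rfl
      rw [h3, charpoly_mul_comm, ← mul_assoc, Unitary.coe_star_mul_self, one_mul]
    rw [h1, h2, charpoly_diagonal]
  have hroots' : H.charpoly.roots
      = Finset.univ.val.map fun i => -(hH.eigenvalues i : ℂ) := by
    rw [hneg, Polynomial.roots_prod _ _ (Finset.prod_ne_zero_iff.2 fun i _ =>
      Polynomial.X_sub_C_ne_zero _)]
    simp
  rw [hroots] at hroots'
  have := congrArg (fun s : Multiset ℂ => (s.map fun z => f z.re).sum) hroots'
  simpa [Multiset.map_map, Function.comp_def] using this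

/-- Bessel's inequality for complex coordinates of real skew-symmetric matrices. The factor `1 / 2`
comes from projecting a rank-one tensor to its skew part. -/
lemma sum_coord_norm_sq_le {ι κ : Type*} [Fintype ι] [Fintype κ] [DecidableEq ι] [DecidableEq κ]
    (b : κ → Matrix ι ι ℝ) (hskew : ∀ s, (b s)ᵀ = -b s)
    (horth : ∀ s t, ∑ i, ∑ j, b s i j * b t i j = if s = t then 1 else 0)
    (V : Matrix ι ι ℂ) (hV : Vᴴ * V = 1) (p q : ι) :
    ∑ s, ‖(Vᵀ * (b s).map Complex.ofReal * V) p q‖ ^ 2 ≤ 1 / 2 := by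
  set e : ι → ι → ℂ := fun i j => V i p * V j q with he
  let v : EuclideanSpace ℂ (ι × ι) := WithLp.toLp 2 fun z => (e z.1 z.2 - e z.2 z.1) / 2
  let β : κ → EuclideanSpace ℂ (ι × ι) := fun s => WithLp.toLp 2 fun z => ((b s z.1 z.2 : ℝ) : ℂ)
  have hβ : Orthonormal ℂ β := by
    rw [orthonormal_iff_ite]
    intro s t
    have h := congrArg (Complex.ofReal) (horth t s)
    simp only [β, PiLp.inner_apply, Fintype.sum_prod_type, RCLike.inner_apply, Complex.conj_ofReal]
    push_cast at h
    rw [h]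
    by_cases hst : s = t
    · simp [hst]
    · simp [hst, Ne.symm hst]
  have hcol : ∀ p q, ∑ i, star (V i p) * V i q = if p = q then 1 else 0 := by
    intro p q
    simpa [mul_apply, one_apply] using congrFun (congrFun hV p) q
  have hcoord : ∀ s, (Vᵀ * (b s).map Complex.ofReal * V) p q = inner ℂ (β s) v := by
    intro s
    have h1 : (Vᵀ * (b s).map Complex.ofReal * V) p q = ∑ i, ∑ j, e i j * (b s i j : ℂ) := by
      simp only [mul_apply, transpose_apply, map_apply, Finset.sum_mul, he]
      rw [Finset.sum_comm]
      refine Finset.sum_congr rfl fun i _ => Finset.sum_congr rfl fun j _ => ?_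
      ring
    have h2 : ∑ i, ∑ j, e j i * (b s i j : ℂ) = -∑ i, ∑ j, e i j * (b s i j : ℂ) := by
      rw [Finset.sum_comm]
      simp only [← Finset.sum_neg_distrib]
      refine Finset.sum_congr rfl fun i _ => Finset.sum_congr rfl fun j _ => ?_
      have : b s j i = -b s i j := congrFun (congrFun (hskew s) i) j
      rw [this]; push_cast; ring
    have h3 : inner ℂ (β s) v = ∑ i, ∑ j, (e i j * (b s i j : ℂ) - e j i * (b s i j : ℂ)) / 2 := by
      simp only [β, v, PiLp.inner_apply, Fintype.sum_prod_type, RCLike.inner_apply,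
        Complex.conj_ofReal]
      refine Finset.sum_congr rfl fun i _ => Finset.sum_congr rfl fun j _ => ?_
      ring
    rw [h1, h3]
    simp only [← Finset.sum_div, Finset.sum_sub_distrib]
    rw [h2]; ring
  have hv : ‖v‖ ^ 2 ≤ 1 / 2 := by
    have hprod : ∀ a b c d : ι, ∑ i, ∑ j, star (V i a * V j b) * (V i c * V j d)
        = (if a = c then 1 else 0) * (if b = d then 1 else 0) := by
      intro a b c d
      rw [← hcol a c, ← hcol b d, Finset.sum_mul_sum]
      refine Finset.sum_congr rfl fun i _ => Finset.sum_congr rfl fun j _ => ?_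
      rw [star_mul']; ring
    have h1 : ((‖v‖ ^ 2 : ℝ) : ℂ) = (1 - if p = q then 1 else 0) / 2 := by
      rw [EuclideanSpace.norm_sq_eq]
      push_cast
      simp only [← Complex.conj_mul', Fintype.sum_prod_type, v]
      have h2 : ∀ i j, (starRingEnd ℂ) ((e i j - e j i) / 2) * ((e i j - e j i) / 2)
          = (star (V i p * V j q) * (V i p * V j q) - star (V i p * V j q) * (V i q * V j p)
            - star (V i q * V j p) * (V i p * V j q)
            + star (V i q * V j p) * (V i q * V j p)) / 4 := by
        intro i j
        simp only [he, map_div₀, map_sub, map_mul, star_mul', Complex.star_def, map_ofNat]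
        ring
      simp only [h2, ← Finset.sum_div, Finset.sum_add_distrib, Finset.sum_sub_distrib, hprod]
      by_cases hpq : p = q
      · simp [hpq]
      · simp [hpq, Ne.symm hpq]; norm_num
    have h3 : ‖v‖ ^ 2 = (1 - if p = q then 1 else 0) / 2 := by
      apply Complex.ofReal_injective
      rw [h1]
      split_ifs <;> simp
    rw [h3]
    split_ifs <;> norm_num
  simp only [hcoord]
  exact (hβ.sum_inner_products_le v (s := Finset.univ)).trans hv

/-- For a skew-symmetric `A` of norm `1` and `k` orthonormal skew-symmetric matrices, the squared norms
of the commutators with `A` sum to at most `2 (k + 1) / 3`. -/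
lemma sum_frobSq_matComm_le {n : ℕ} {κ : Type*} [Fintype κ] [DecidableEq κ]
    (A : Matrix (Fin n) (Fin n) ℝ) (hA : Aᵀ = -A) (hA1 : frobSq A = 1)
    (b : κ → Matrix (Fin n) (Fin n) ℝ) (hskew : ∀ s, (b s)ᵀ = -b s)
    (horth : ∀ s t, ∑ i, ∑ j, b s i j * b t i j = if s = t then 1 else 0) :
    ∑ s, frobSq (matComm A (b s)) ≤ 2 / 3 * (Fintype.card κ + 1) := by
  set c : Matrix (Fin n) (Fin n) ℝ → Matrix (Fin n) (Fin n) ℂ := fun M => M.map Complex.ofReal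
    with hc
  set H : Matrix (Fin n) (Fin n) ℂ := Complex.I • c A with hHdef
  have hcT : ∀ M : Matrix (Fin n) (Fin n) ℝ, Mᵀ = -M → (c M)ᵀ = -c M := by
    intro M hM
    ext i j
    have : M j i = -M i j := congrFun (congrFun hM i) j
    simp [hc, this]
  have hHT : Hᵀ = -H := by rw [hHdef, transpose_smul, hcT A hA, smul_neg]
  have hH : H.IsHermitian := by
    ext i j
    have : A j i = -A i j := congrFun (congrFun hA i) j
    simp [hHdef, hc, this]
  set U : Matrix (Fin n) (Fin n) ℂ := (hH.eigenvectorUnitary).1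
  set x := hH.eigenvalues with hxdef
  set D : Matrix (Fin n) (Fin n) ℂ := diagonal fun i => (x i : ℂ) with hD
  have hUU : U * Uᴴ = 1 := Unitary.coe_mul_star_self hH.eigenvectorUnitary
  have hUU' : Uᴴ * U = 1 := Unitary.coe_star_mul_self hH.eigenvectorUnitary
  have hspec : H = U * D * Uᴴ := by
    conv_lhs => rw [hH.spectral_theorem, Unitary.conjStarAlgAut_apply]
    rfl
  have hleft : Uᴴ * H = D * Uᴴ := by
    rw [hspec, ← Matrix.mul_assoc, ← Matrix.mul_assoc, hUU', Matrix.one_mul]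
  set V : Matrix (Fin n) (Fin n) ℂ := Uᴴᵀ with hV
  have hVV : Vᴴ * V = 1 := by
    have : Vᴴ = Uᵀ := by ext i j; simp [hV]
    rw [this, hV, ← transpose_mul, hUU', transpose_one]
  have hVV' : V * Vᴴ = 1 := mul_eq_one_comm.1 hVV
  have hVT : Vᵀ = Uᴴ := transpose_transpose _
  have hright : H * V = -(V * D) := by
    have := congrArg transpose hleft
    rw [transpose_mul, transpose_mul, hHT, hD, diagonal_transpose, ← hD, ← hV] at this
    rw [← this, Matrix.neg_mul, neg_neg]
  set C : κ → Matrix (Fin n) (Fin n) ℂ := fun s => Vᵀ * c (b s) * V with hC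
  have hCT : ∀ s, (C s)ᵀ = -C s := by
    intro s
    simp only [hC, transpose_mul, transpose_transpose, hcT _ (hskew s), Matrix.mul_neg,
      Matrix.neg_mul, Matrix.mul_assoc]
  have hfrob : ∀ M, frobSq M = ∑ i, ∑ j, ‖c M i j‖ ^ 2 := by
    intro M; simp [frobSq, hc]
  have hcomm : ∀ s, frobSq (matComm A (b s)) = ∑ p, ∑ q, ‖C s p q‖ ^ 2 * (x p + x q) ^ 2 := by
    intro s
    have h1 : Vᵀ * (H * c (b s) - c (b s) * H) * V = D * C s + C s * D := by
      calc Vᵀ * (H * c (b s) - c (b s) * H) * V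
          = (Uᴴ * H) * c (b s) * V - Vᵀ * c (b s) * (H * V) := by
            rw [hVT]; noncomm_ring
        _ = D * C s + C s * D := by
            rw [hleft, hright]; simp only [hC, hVT]; noncomm_ring
    have h2 : H * c (b s) - c (b s) * H = Complex.I • c (matComm A (b s)) := by
      have : c (matComm A (b s)) = c A * c (b s) - c (b s) * c A := by
        ext i j; simp [hc, matComm, mul_apply]
      rw [this, hHdef, smul_mul_assoc, mul_smul_comm, smul_sub]
    have h3 : ∑ i, ∑ j, ‖(D * C s + C s * D) i j‖ ^ 2 = frobSq (matComm A (b s)) := by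
      rw [← h1, sum_norm_sq_mul_mul_of_unitary _ _ _ (by rw [hVT, conjTranspose_conjTranspose, hUU])
        hVV', h2, hfrob]
      simp
    rw [← h3]
    refine Finset.sum_congr rfl fun p _ => Finset.sum_congr rfl fun q _ => ?_
    have : (D * C s + C s * D) p q = ((x p + x q : ℝ) : ℂ) * C s p q := by
      simp [hD]; ring
    rw [this, norm_mul, mul_pow, Complex.norm_real, Real.norm_eq_abs, sq_abs, mul_comm]
  have hCnorm : ∀ s, ∑ p, ∑ q, ‖C s p q‖ ^ 2 = 1 := by
    intro s
    rw [sum_norm_sq_mul_mul_of_unitary _ _ _ (by rw [hVT, conjTranspose_conjTranspose, hUU]) hVV',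
      ← hfrob]
    simpa [frobSq, sq] using horth s s
  set w : Fin n → Fin n → ℝ := fun p q => ∑ s, ‖C s p q‖ ^ 2 with hw
  have hwsum : ∑ p, ∑ q, w p q = Fintype.card κ := by
    simp only [hw]
    calc ∑ p, ∑ q, ∑ s, ‖C s p q‖ ^ 2 = ∑ s, ∑ p, ∑ q, ‖C s p q‖ ^ 2 := by
          rw [Finset.sum_comm (s := (Finset.univ : Finset κ))]
          exact Finset.sum_congr rfl fun p _ => Finset.sum_comm
      _ = Fintype.card κ := by simp [hCnorm]
  have hxsum : ∑ p, x p ^ 2 = 1 := by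
    have h1 : ∑ i, ∑ j, ‖H i j‖ ^ 2 = 1 := by
      rw [← hA1, hfrob]; simp [hHdef]
    rw [hspec, sum_norm_sq_mul_mul_of_unitary _ _ _ hUU' (by rw [conjTranspose_conjTranspose, hUU'])]
      at h1
    rw [← h1]
    refine Finset.sum_congr rfl fun p _ => ?_
    rw [Finset.sum_eq_single p (fun q _ hq => by simp [hD, hq.symm]) (by simp)]
    simp [hD]
  have hsym := sum_eigenvalues_neg hH hHT fun y => if 0 < y then y ^ 2 else 0
  have hneg : ∑ p with ¬ 0 < x p, x p ^ 2 = ∑ p with 0 < x p, x p ^ 2 := by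
    rw [Finset.sum_filter, Finset.sum_filter]
    refine Eq.trans (Finset.sum_congr rfl fun p _ => ?_) hsym.symm
    rcases lt_trichotomy (x p) 0 with h | h | h
    · simp [h, h.not_gt, ← hxdef]
    · simp [h, ← hxdef]
    · simp [h, h.not_gt, ← hxdef]
  have hsplit := Finset.sum_filter_add_sum_filter_not Finset.univ (fun p => 0 < x p)
    fun p => x p ^ 2
  have hmain := sum_weight_mul_add_sq_le x w (by linarith) (by linarith)
    (fun p q => Finset.sum_nonneg fun s _ => by positivity)
    (fun p q => sum_coord_norm_sq_le b hskew horth V hVV p q)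
    (fun p q => Finset.sum_congr rfl fun s _ => by
      rw [show C s p q = -C s q p from congrFun (congrFun (hCT s) q) p, norm_neg])
    (fun p => Finset.sum_eq_zero fun s _ => by
      have : C s p p = -C s p p := congrFun (congrFun (hCT s) p) p
      simp [self_eq_neg.1 this])
  rw [hwsum] at hmain
  refine le_trans (le_of_eq ?_) hmain
  simp only [hcomm, hw, Finset.sum_mul]
  rw [Finset.sum_comm]
  exact Finset.sum_congr rfl fun p _ => Finset.sum_comm

lemma frobSq_nonneg {n : ℕ} (A : Matrix (Fin n) (Fin n) ℝ) : 0 ≤ frobSq A :=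
  Finset.sum_nonneg fun _ _ => Finset.sum_nonneg fun _ _ => sq_nonneg _

lemma frobSq_smul {n : ℕ} (a : ℝ) (A : Matrix (Fin n) (Fin n) ℝ) :
    frobSq (a • A) = a ^ 2 * frobSq A := by
  simp [frobSq, mul_pow, Finset.mul_sum]

lemma matComm_smul_smul {n : ℕ} (a b : ℝ) (A B : Matrix (Fin n) (Fin n) ℝ) :
    matComm (a • A) (b • B) = (a * b) • matComm A B := by
  simp only [matComm, smul_mul_assoc, mul_smul_comm, smul_smul, smul_sub, mul_comm b a]

lemma frobSq_matComm_comm {n : ℕ} (A B : Matrix (Fin n) (Fin n) ℝ) :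
    frobSq (matComm A B) = frobSq (matComm B A) := by
  have : matComm A B = (-1 : ℝ) • matComm B A := by simp [matComm]
  rw [this, frobSq_smul]; norm_num

lemma matComm_self {n : ℕ} (A : Matrix (Fin n) (Fin n) ℝ) : matComm A A = 0 := sub_self _

lemma sum_frobSq_matComm_smul_le {n : ℕ} {κ : Type*} [Fintype κ] [DecidableEq κ]
    (b : κ → Matrix (Fin n) (Fin n) ℝ) (hskew : ∀ s, (b s)ᵀ = -b s)
    (horth : ∀ s t, ∑ i, ∑ j, b s i j * b t i j = if s = t then 1 else 0)
    (x : κ → ℝ) (hx : ∀ r, 0 ≤ x r) :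
    ∑ r, ∑ s, x r * x s * frobSq (matComm (b r) (b s)) ≤ 2 / 3 * (∑ r, x r) ^ 2 := by
  refine quadratic_le_of_column_sums _ _ (fun r s => frobSq_matComm_comm _ _) ?_ x hx
  intro K s hs
  have h := sum_frobSq_matComm_le (κ := K.erase s) (b s) (hskew s)
    (by simpa [frobSq, sq] using horth s s) (fun r => b r) (fun r => hskew r)
    (fun r t => by rw [horth]; simp only [Subtype.ext_iff])
  rw [Finset.sum_coe_sort (K.erase s) fun r => frobSq (matComm (b s) (b r)), Fintype.card_coe,
    Finset.card_erase_of_mem hs, Nat.cast_sub (Finset.card_pos.2 ⟨s, hs⟩)] at h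
  rw [← Finset.add_sum_erase _ _ hs, matComm_self]
  simp only [fun r => frobSq_matComm_comm (b r) (b s)]
  simpa [frobSq] using h

lemma sum_frobSq_matComm_le_of_orthogonal {n : ℕ} {κ : Type*} [Fintype κ] [DecidableEq κ]
    (B : κ → Matrix (Fin n) (Fin n) ℝ) (hskew : ∀ s, (B s)ᵀ = -B s)
    (horth : ∀ s t, s ≠ t → ∑ i, ∑ j, B s i j * B t i j = 0) :
    ∑ r, ∑ s, frobSq (matComm (B r) (B s)) ≤ 2 / 3 * (∑ r, frobSq (B r)) ^ 2 := by
  set S : Finset κ := Finset.univ.filter fun r => frobSq (B r) ≠ 0 with hS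
  have hzero : ∀ r, r ∉ S → B r = 0 := by
    intro r hr
    have h0 : frobSq (B r) = 0 := by simpa [hS] using hr
    ext i j
    have h1 := (Finset.sum_eq_zero_iff_of_nonneg fun k _ => Finset.sum_nonneg
      fun l _ => sq_nonneg (B r k l)).1 h0 i (Finset.mem_univ _)
    have := (Finset.sum_eq_zero_iff_of_nonneg fun l _ => sq_nonneg (B r i l)).1 h1 j
      (Finset.mem_univ _)
    simpa using this
  have hsum : ∀ f : κ → ℝ, (∀ r, r ∉ S → f r = 0) → ∑ r, f r = ∑ r : S, f r := by
    intro f hf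
    rw [Finset.sum_coe_sort S f]
    exact (Finset.sum_subset (Finset.subset_univ _) fun r _ hr => hf r hr).symm
  have hpos : ∀ r : S, 0 < frobSq (B r) := fun r =>
    (frobSq_nonneg _).lt_of_ne' (Finset.mem_filter.1 r.2).2
  have h := sum_frobSq_matComm_smul_le (fun r : S => (√(frobSq (B r)))⁻¹ • B r)
    (fun r => by rw [transpose_smul, hskew, smul_neg]) (fun r t => by
      have e : ∑ i, ∑ j, ((√(frobSq (B r)))⁻¹ • B r) i j * ((√(frobSq (B t)))⁻¹ • B t) i j
          = (√(frobSq (B r)))⁻¹ * (√(frobSq (B t)))⁻¹ * ∑ i, ∑ j, B r i j * B t i j := by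
        simp only [Finset.mul_sum, Matrix.smul_apply, smul_eq_mul]
        refine Finset.sum_congr rfl fun i _ => Finset.sum_congr rfl fun j _ => ?_
        ring
      rw [e]
      split_ifs with hrt
      · subst hrt
        have : ∑ i, ∑ j, B r i j * B r i j = frobSq (B r) := by simp [frobSq, sq]
        rw [this, ← mul_inv, Real.mul_self_sqrt (hpos r).le, inv_mul_cancel₀ (hpos r).ne']
      · rw [horth _ _ fun h => hrt (Subtype.ext h), mul_zero])
    (fun r => frobSq (B r)) (fun r => (hpos r).le)
  rw [hsum (fun r => frobSq (B r)) fun r hr => by simp [hzero r hr, frobSq],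
    hsum _ fun r hr => by simp [hzero r hr, frobSq, matComm]]
  refine le_trans (le_of_eq ?_) h
  refine Finset.sum_congr rfl fun r _ => ?_
  rw [hsum _ fun s hs => by simp [hzero s hs, frobSq, matComm]]
  refine Finset.sum_congr rfl fun s _ => ?_
  rw [matComm_smul_smul, frobSq_smul, mul_pow, inv_pow, inv_pow, Real.sq_sqrt (hpos r).le,
    Real.sq_sqrt (hpos s).le]
  have := (hpos r).ne'
  have := (hpos s).ne'
  field_simp

/-- The optimal commutator inequality for real skew-symmetric `n × n` matrices, `n ≥ 4`. -/
theorem ddvv_skew (n m : ℕ) (hn : 4 ≤ n) (hm : 0 < m)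
    (B : Fin m → Matrix (Fin n) (Fin n) ℝ)
    (hskew : ∀ r, (B r)ᵀ = -B r) :
    ∑ r, ∑ s, frobSq (matComm (B r) (B s)) ≤ (2 / 3) * (∑ r, frobSq (B r)) ^ 2 := by
  set F : Matrix (Fin n × Fin n) (Fin m) ℝ := of fun z r => B r z.1 z.2 with hF
  have hGH : (Fᵀ * F).IsHermitian := isHermitian_conjTranspose_mul_self F
  set U : Matrix (Fin m) (Fin m) ℝ := (hGH.eigenvectorUnitary).1
  have hUU : U * Uᵀ = 1 := Unitary.coe_mul_star_self hGH.eigenvectorUnitary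
  have hUU' : Uᵀ * U = 1 := Unitary.coe_star_mul_self hGH.eigenvectorUnitary
  have hspec : Uᵀ * (Fᵀ * F) * U = diagonal hGH.eigenvalues := by
    have h : Fᵀ * F = U * diagonal hGH.eigenvalues * Uᵀ := by
      conv_lhs => rw [hGH.spectral_theorem, Unitary.conjStarAlgAut_apply]
      rfl
    calc Uᵀ * (Fᵀ * F) * U = Uᵀ * (U * diagonal hGH.eigenvalues * Uᵀ) * U := by
          conv_lhs => rw [h]
      _ = (Uᵀ * U) * diagonal hGH.eigenvalues * (Uᵀ * U) := by simp only [Matrix.mul_assoc]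
      _ = _ := by rw [hUU']; simp
  set B' : Fin m → Matrix (Fin n) (Fin n) ℝ := fun k => ∑ r, U r k • B r with hB'
  have hB'apply : ∀ k i j, B' k i j = ∑ r, B r i j * U r k := by
    intro k i j
    simp [hB', Matrix.sum_apply, mul_comm]
  have hrot : ∀ X : Fin m → Matrix (Fin n) (Fin n) ℝ,
      ∑ k, frobSq (∑ r, U r k • X r) = ∑ r, frobSq (X r) := by
    intro X
    simp only [frobSq]
    rw [Finset.sum_comm, Finset.sum_comm (s := (Finset.univ : Finset (Fin m)))]
    refine Finset.sum_congr rfl fun i _ => ?_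
    rw [Finset.sum_comm, Finset.sum_comm (s := (Finset.univ : Finset (Fin m)))]
    refine Finset.sum_congr rfl fun j _ => ?_
    rw [← sum_sq_vecMul_of_orthogonal U hUU fun r => X r i j]
    simp [Matrix.sum_apply, mul_comm]
  have hcomm : ∑ k, ∑ l, frobSq (matComm (B' k) (B' l)) =
      ∑ r, ∑ s, frobSq (matComm (B r) (B s)) := by
    have h1 : ∀ X k, matComm X (B' k) = ∑ s, U s k • matComm X (B s) := by
      intro X k
      simp only [hB', matComm, Finset.mul_sum, Finset.sum_mul, mul_smul_comm, smul_mul_assoc,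
        smul_sub, Finset.sum_sub_distrib]
    simp only [h1, hrot]
    simp only [fun k s => frobSq_matComm_comm (B' k) (B s), h1]
    rw [Finset.sum_comm]
    simp only [hrot]
  have hortho : ∀ k l, k ≠ l → ∑ i, ∑ j, B' k i j * B' l i j = 0 := by
    intro k l hkl
    have h1 : ∑ i, ∑ j, B' k i j * B' l i j = ((F * U)ᵀ * (F * U)) k l := by
      simp [hB'apply, mul_apply, hF, Fintype.sum_prod_type, mul_comm]
    rw [transpose_mul, Matrix.mul_assoc, ← Matrix.mul_assoc Fᵀ, ← Matrix.mul_assoc] at h1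
    rw [h1, hspec, diagonal_apply_ne _ hkl]
  have h := sum_frobSq_matComm_le_of_orthogonal B' (fun k => by
    simp only [hB', transpose_sum, transpose_smul, hskew, smul_neg, Finset.sum_neg_distrib]) hortho
  rwa [hcomm, hrot] at h
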